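/- Let m be a positive integer or half-integer (2m ∈ ℕ) and let n, ν be integers with 0 ≤ n < 2m and 0 ≤ ν ≤ 2m. Let τ lie in the upper half-plane and z ∈ ℂ with m·z ∉ ℤ + ℤτ. Then G^{[m]}_{n,ν}(−1/τ, z/τ) = i (−iτ)^{3/2}/(2m√(2m+1)) ∑_{n'=0}^{2m−1} ∑_{ν'=0}^{2m} ∑_{ℓ=0}^{2m−1} (−1)^{ν+ν'} e^{πinℓ/m} e^{−πi(ν+1/2)(ν'+1/2)/(m+1/2)} e^{πimz²/(2τ)} e^{−πiℓz} q^{ℓ²/(4m)} G^{[m]}_{n',ν'}(τ, z − ℓτ/m), where (−iτ)^{3/2} denotes the principal branch. -/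

import Mathlib

noncomputable section

open Complex

/-- `e2 w = exp (2 π i w)`; with `q = e^{2πiτ}`, the power `q^x` corresponds to `e2 (x * τ)`. -/
def e2 (w : ℂ) : ℂ := Complex.exp (2 * (Real.pi : ℂ) * Complex.I * w)

/-- Jacobi-type theta function `θ^{(ε)}_{n,m}(τ, z) = ∑_{j∈ℤ} ε^j q^{m(j+n/(2m))²} e^{2πim(j+n/(2m))z}`. -/
def jtheta (ε n m τ z : ℂ) : ℂ :=
  ∑' j : ℤ, ε ^ j *
    e2 (m * ((j : ℂ) + n / (2 * m)) ^ 2 * τ + m * ((j : ℂ) + n / (2 * m)) * z)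

/-- Mock theta function `Φ₁^{(ε)[m,s]}(τ, z₁, z₂)`. -/
def Phi1 (ε m s τ z₁ z₂ : ℂ) : ℂ :=
  ∑' j : ℤ, ε ^ j *
    e2 (m * (j : ℂ) * (z₁ + z₂) + s * z₁ + (m * (j : ℂ) ^ 2 + s * (j : ℂ)) * τ) /
      (1 - e2 (z₁ + (j : ℂ) * τ))

/-- Dedekind eta function `η(τ) = q^{1/24} ∏_{k≥1} (1 - q^k)`. -/
def dedekindEta (τ : ℂ) : ℂ := e2 (τ / 24) * ∏' k : ℕ, (1 - e2 (((k : ℂ) + 1) * τ))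

/-- Jacobi theta `ϑ₁₁(τ, z) = i ∑_{j∈ℤ} (−1)^j q^{(j+1/2)²/2} e^{2πi(j+1/2)z}`. -/
def theta11 (τ z : ℂ) : ℂ :=
  Complex.I * ∑' j : ℤ, (-1 : ℂ) ^ j *
    e2 (((j : ℂ) + 1 / 2) ^ 2 / 2 * τ + ((j : ℂ) + 1 / 2) * z)

/-- Indefinite double sum `(∑_{j,p∈ℤ, 0<p≤j} − ∑_{j,p∈ℤ, j<p≤0}) f j p`. -/
def indefSum (f : ℤ → ℤ → ℂ) : ℂ :=
  ∑' jp : ℤ × ℤ,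
    ((if 0 < jp.2 ∧ jp.2 ≤ jp.1 then f jp.1 jp.2 else 0) -
      (if jp.1 < jp.2 ∧ jp.2 ≤ 0 then f jp.1 jp.2 else 0))

/-- `g^{[m]}_{n,ν}(τ)`. -/
def gfun (m : ℂ) (n ν : ℤ) (τ : ℂ) : ℂ :=
  indefSum fun j p =>
    (-1 : ℂ) ^ j *
      e2 (((m + 1 / 2) * ((j : ℂ) + (ν : ℂ) - ((ν : ℂ) + 1 / 2) / (2 * m + 1)) ^ 2 -
        m * ((p : ℂ) + (ν : ℂ) - (n : ℂ) / (2 * m)) ^ 2) * τ)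

/-- `h^{[m]}_{n,ν}(τ, z)`. -/
def hfun (m : ℂ) (n ν : ℤ) (τ z : ℂ) : ℂ :=
  ∑' j : ℤ,
    e2 (m * (j : ℂ) * z + (n : ℂ) * z / 2 +
        (m * (j : ℂ) ^ 2 + (n : ℂ) * ((j : ℂ) + (ν : ℂ))) * τ) /
      (1 - e2 (m * z + 2 * m * ((j : ℂ) + (ν : ℂ)) * τ))

/-- `G^{[m]}_{n,ν}(τ, z)`. -/
def Gfun (m : ℂ) (n ν : ℤ) (τ z : ℂ) : ℂ :=
  gfun m n ν τ * jtheta 1 (n : ℂ) m τ z +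
    (-1 : ℂ) ^ ν * e2 (-(m * (ν : ℂ) ^ 2) * τ) *
      jtheta (-1) ((ν : ℂ) + 1 / 2) (m + 1 / 2) τ 0 * hfun m n ν τ z

/-- `F^{[m](a,b)}_{n,ν}(τ, z)`. -/
def Ffun (m : ℂ) (a b n ν : ℤ) (τ z : ℂ) : ℂ :=
  e2 ((a : ℂ) * z / 2 + (a : ℂ) ^ 2 / (4 * m) * τ) *
    Gfun m n ν τ (z + (a : ℂ) * τ / m + (b : ℂ) / m)

/-- The coefficient `f_{j,k}` of Lemma 3.1:
`f_{j,k} = (−1)^j q^{(m+1/2)(j+s/(2m+1))² − k²/(4m)} e^{−2πijm(z₁−z₂)+πik(z₁−z₂)}`. -/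
def fcoef (m s τ z₁ z₂ : ℂ) (j k : ℤ) : ℂ :=
  (-1 : ℂ) ^ j *
    e2 (((m + 1 / 2) * ((j : ℂ) + s / (2 * m + 1)) ^ 2 - (k : ℂ) ^ 2 / (4 * m)) * τ +
      (-((j : ℂ) * m) + (k : ℂ) / 2) * (z₁ - z₂))


/-! ### Basic facts about `e2` -/

lemma e2_add (a b : ℂ) : e2 (a + b) = e2 a * e2 b := by
  simp only [e2, ← Complex.exp_add]; ring_nf

lemma e2_zero : e2 0 = 1 := by simp [e2]

lemma e2_ne_zero (a : ℂ) : e2 a ≠ 0 := Complex.exp_ne_zero _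

lemma e2_neg (a : ℂ) : e2 (-a) = (e2 a)⁻¹ := by
  simp only [e2, ← Complex.exp_neg]; ring_nf

lemma e2_int (k : ℤ) : e2 (k : ℂ) = 1 := by
  rw [e2, Complex.exp_eq_one_iff]; exact ⟨k, by ring⟩

lemma e2_add_int (a : ℂ) (k : ℤ) : e2 (a + k) = e2 a := by
  rw [e2_add, e2_int, mul_one]

lemma e2_half : e2 (1 / 2) = -1 := by
  rw [e2, show 2 * (Real.pi : ℂ) * I * (1 / 2) = Real.pi * I by ring, Complex.exp_pi_mul_I]

lemma e2_nat_mul (k : ℕ) (a : ℂ) : e2 (k * a) = e2 a ^ k := by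
  simp only [e2, ← Complex.exp_nat_mul]; ring_nf

lemma e2_int_mul (k : ℤ) (a : ℂ) : e2 (k * a) = e2 a ^ k := by
  simp only [e2, ← Complex.exp_int_mul]; ring_nf

lemma neg_one_zpow_eq (k : ℤ) : (-1 : ℂ) ^ k = e2 (k / 2) := by
  rw [show (k : ℂ) / 2 = k * (1 / 2) by ring, e2_int_mul, e2_half]

/-- Two values of `e2` agree when the arguments differ by an integer. -/
lemma e2_congr {a b : ℂ} (k : ℤ) (h : a = b + k) : e2 a = e2 b := by
  rw [h, e2_add_int]

lemma e2_eq_one_iff (a : ℂ) : e2 a = 1 ↔ ∃ k : ℤ, a = k := by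
  rw [e2, Complex.exp_eq_one_iff]
  constructor
  · rintro ⟨k, hk⟩
    refine ⟨k, ?_⟩
    have : (2 * (Real.pi : ℂ) * I) ≠ 0 := Complex.two_pi_I_ne_zero
    apply mul_left_cancel₀ this
    rw [hk]; ring
  · rintro ⟨k, hk⟩
    exact ⟨k, by rw [hk]; ring⟩

lemma norm_e2 (a : ℂ) : ‖e2 a‖ = Real.exp (-(2 * Real.pi * a.im)) := by
  rw [e2, Complex.norm_exp]; congr 1
  simp [Complex.mul_re, Complex.mul_im]

lemma differentiable_e2 : Differentiable ℂ e2 := by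
  unfold e2; fun_prop

@[fun_prop]
lemma differentiable_e2_comp {f : ℂ → ℂ} (hf : Differentiable ℂ f) :
    Differentiable ℂ (fun u => e2 (f u)) := by
  unfold e2; fun_prop

@[fun_prop]
lemma differentiableAt_e2_comp {f : ℂ → ℂ} {x : ℂ} (hf : DifferentiableAt ℂ f x) :
    DifferentiableAt ℂ (fun u => e2 (f u)) x := by
  unfold e2; fun_prop

lemma continuous_e2 : Continuous e2 := differentiable_e2.continuous

lemma hasDerivAt_e2_zero : HasDerivAt e2 (2 * Real.pi * I) 0 := by
  have h := ((hasDerivAt_id (0 : ℂ)).const_mul (2 * (Real.pi : ℂ) * I)).cexp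
  simp only [id, mul_zero, Complex.exp_zero, one_mul, mul_one] at h
  exact h

/-! ### Summability -/

/-- One-dimensional Gaussian sums converge absolutely. -/
lemma summable_gauss (a b c : ℂ) (ha : 0 < a.im) :
    Summable fun j : ℤ => e2 (a * (j : ℂ) ^ 2 + b * j + c) := by
  have h := (summable_jacobiTheta₂_term_iff b (2 * a)).2 (by simpa using ha)
  refine (h.mul_right (e2 c)).congr fun j => ?_
  rw [e2_add, jacobiTheta₂_term, e2]
  congr 2; ring

/-- The reciprocals `1 / (1 - e2 (u + kσ))` are bounded by `2`, uniformly in strips, for large `k`. -/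
lemma inv_bound_large (σ : ℂ) (hσ : 0 < σ.im) (A : ℝ) :
    ∃ F : Finset ℤ, 0 ∈ F ∧ ∀ k ∉ F, ∀ u : ℂ, |u.im| < A →
      1 - e2 (u + k * σ) ≠ 0 ∧ ‖(1 - e2 (u + k * σ))⁻¹‖ ≤ 2 := by
  obtain ⟨K, hK⟩ := exists_nat_gt ((A + 1) / σ.im)
  have hK' : A + 1 < K * σ.im := by rwa [div_lt_iff₀ hσ] at hK
  refine ⟨Finset.Icc (-(K : ℤ)) K, by simp, fun k hk u hu => ?_⟩
  have him : (u + k * σ).im = u.im + k * σ.im := by simp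
  have hpi := Real.pi_gt_three
  obtain ⟨hu1, hu2⟩ := abs_lt.1 hu
  have e1 : (2 : ℝ) ≤ Real.exp 1 := by have := Real.add_one_le_exp (1 : ℝ); linarith
  have key : (1 / 2 : ℝ) ≤ ‖1 - e2 (u + k * σ)‖ := by
    rcases lt_or_ge k (-(K : ℤ)) with h | h
    · have hk2 : (k : ℝ) < -K := by exact_mod_cast h
      have h1 : (u + k * σ).im < -1 := by rw [him]; nlinarith
      have h2 : 2 ≤ ‖e2 (u + k * σ)‖ := by
        rw [norm_e2]
        refine e1.trans (Real.exp_le_exp.2 ?_)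
        nlinarith
      have := norm_sub_norm_le (e2 (u + k * σ)) 1
      rw [norm_sub_rev] at this
      rw [norm_one] at this
      linarith
    · have hk2 : (K : ℤ) < k := by
        by_contra hh; exact hk (Finset.mem_Icc.2 ⟨h, not_lt.1 hh⟩)
      have hk2 : (K : ℝ) < k := by exact_mod_cast hk2
      have h1 : 1 < (u + k * σ).im := by rw [him]; nlinarith
      have h2 : ‖e2 (u + k * σ)‖ ≤ 1 / 2 := by
        rw [norm_e2]
        have : Real.exp (-(2 * Real.pi * (u + k * σ).im)) ≤ Real.exp (-1) :=
          Real.exp_le_exp.2 (by nlinarith)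
        refine this.trans ?_
        rw [Real.exp_neg, one_div]
        exact inv_anti₀ (by norm_num) e1
      have := norm_sub_norm_le 1 (e2 (u + k * σ))
      rw [norm_one] at this
      linarith
  refine ⟨fun h0 => by rw [h0, norm_zero] at key; norm_num at key, ?_⟩
  rw [norm_inv]
  calc ‖1 - e2 (u + k * σ)‖⁻¹ ≤ (1 / 2 : ℝ)⁻¹ := inv_anti₀ (by norm_num) key
    _ = 2 := by norm_num

lemma inv_bound (σ : ℂ) (hσ : 0 < σ.im) (u : ℂ) :
    ∃ B : ℝ, ∀ k : ℤ, ‖(1 - e2 (u + k * σ))⁻¹‖ ≤ B := by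
  obtain ⟨F, -, hF⟩ := inv_bound_large σ hσ (|u.im| + 1)
  refine ⟨2 + ∑ k ∈ F, ‖(1 - e2 (u + k * σ))⁻¹‖, fun k => ?_⟩
  by_cases hk : k ∈ F
  · have := Finset.single_le_sum (f := fun k : ℤ => ‖(1 - e2 (u + k * σ))⁻¹‖)
      (fun i _ => norm_nonneg _) hk
    linarith
  · have := (hF k hk u (by linarith)).2
    have h2 : 0 ≤ ∑ k ∈ F, ‖(1 - e2 (u + k * σ))⁻¹‖ := Finset.sum_nonneg fun i _ => norm_nonneg _
    linarith

/-- Summability of a Gaussian divided by the bounded denominators. -/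
lemma summable_div {ι : Type*} (f : ι → ℂ) (hf : Summable f) (κ : ι → ℤ) (σ : ℂ) (hσ : 0 < σ.im)
    (u : ℂ) : Summable fun i => f i / (1 - e2 (u + κ i * σ)) := by
  obtain ⟨B, hB⟩ := inv_bound σ hσ u
  refine Summable.of_norm_bounded (hf.norm.mul_right B) fun i => ?_
  rw [div_eq_mul_inv, norm_mul]
  exact mul_le_mul_of_nonneg_left (hB _) (norm_nonneg _)

/-! ### The function `T` and `J` -/

/-- `T τ u s = ∑_k (-1)^k q^{k(k-1)/2 - ks} / (1 - e^{2πiu} q^k)`. -/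
def Tterm (τ u : ℂ) (s k : ℤ) : ℂ :=
  e2 ((k : ℂ) / 2 + ((k : ℂ) * (k - 1) / 2 - k * s) * τ) / (1 - e2 (u + k * τ))

def Tfun (τ u : ℂ) (s : ℤ) : ℂ := ∑' k : ℤ, Tterm τ u s k

def Jfun (τ u : ℂ) : ℂ := e2 (-u / 2) * Tfun τ u 0

lemma summable_Tnum (τ : ℂ) (hτ : 0 < τ.im) (s : ℤ) :
    Summable fun k : ℤ => e2 ((k : ℂ) / 2 + ((k : ℂ) * (k - 1) / 2 - k * s) * τ) := by
  refine (summable_gauss (τ / 2) (1 / 2 - τ / 2 - s * τ) 0 (by simpa using hτ)).congr fun k => ?_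
  congr 1; ring

lemma summable_Tterm (τ u : ℂ) (hτ : 0 < τ.im) (s : ℤ) : Summable (Tterm τ u s) :=
  summable_div _ (summable_Tnum τ hτ s) (fun k => k) τ hτ u

lemma Tnum_sum_zero (τ : ℂ) (s : ℤ) :
    ∑' k : ℤ, e2 ((k : ℂ) / 2 + ((k : ℂ) * (k - 1) / 2 - k * s) * τ) = 0 := by
  have h := (Equiv.subLeft (2 * s + 1)).tsum_eq
    (fun k : ℤ => e2 ((k : ℂ) / 2 + ((k : ℂ) * (k - 1) / 2 - k * s) * τ))
  have h2 : ∀ k : ℤ, e2 ((((Equiv.subLeft (2 * s + 1)) k : ℤ) : ℂ) / 2 +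
      ((((Equiv.subLeft (2 * s + 1)) k : ℤ) : ℂ) * (((Equiv.subLeft (2 * s + 1)) k : ℤ) - 1) / 2 -
        ((Equiv.subLeft (2 * s + 1)) k : ℤ) * s) * τ) =
      -e2 ((k : ℂ) / 2 + ((k : ℂ) * (k - 1) / 2 - k * s) * τ) := by
    intro k
    rw [neg_eq_neg_one_mul, ← e2_half, ← e2_add]
    refine e2_congr (s - k) ?_
    simp only [Equiv.subLeft_apply]
    push_cast; ring
  simp only [h2] at h
  rw [tsum_neg] at h
  exact self_eq_neg.1 h.symm

/-- off-lattice condition -/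
def OffL (τ u : ℂ) : Prop := ∀ a b : ℤ, u ≠ a + b * τ

lemma OffL.ne {τ u : ℂ} (h : OffL τ u) (k : ℤ) : 1 - e2 (u + k * τ) ≠ 0 := by
  intro h0
  obtain ⟨a, ha⟩ := (e2_eq_one_iff _).1 (sub_eq_zero.1 h0).symm
  refine h a (-k) ?_
  push_cast
  linear_combination ha

lemma Tfun_rec (τ u : ℂ) (hτ : 0 < τ.im) (hu : OffL τ u) (s : ℤ) :
    Tfun τ u (s + 1) = e2 u * Tfun τ u s := by
  rw [← sub_eq_zero, Tfun, Tfun, ← tsum_mul_left,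
    ← (summable_Tterm τ u hτ (s + 1)).tsum_sub ((summable_Tterm τ u hτ s).mul_left _),
    ← Tnum_sum_zero τ (s + 1)]
  refine tsum_congr fun k => ?_
  have h0 := hu.ne k
  rw [Tterm, Tterm, mul_div_assoc', ← sub_div, div_eq_iff h0, ← e2_add, mul_sub (e2 _) 1, mul_one, ← e2_add]
  congr 2
  push_cast; ring

lemma Tfun_eq (τ u : ℂ) (hτ : 0 < τ.im) (hu : OffL τ u) (s : ℤ) :
    Tfun τ u s = e2 (s * u) * Tfun τ u 0 := by
  induction s using Int.induction_on with
  | zero => simp [e2_zero]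
  | succ i ih =>
    rw [Tfun_rec τ u hτ hu, ih, ← mul_assoc, ← e2_add]; congr 2; push_cast; ring
  | pred i ih =>
    have := Tfun_rec τ u hτ hu (-(i : ℤ) - 1)
    rw [sub_add_cancel, ih] at this
    have h2 : e2 u ≠ 0 := e2_ne_zero u
    apply mul_left_cancel₀ h2
    rw [← this, ← mul_assoc, ← e2_add]; congr 2; push_cast; ring

lemma Jfun_add_one (τ u : ℂ) : Jfun τ (u + 1) = -Jfun τ u := by
  have : Tfun τ (u + 1) 0 = Tfun τ u 0 := by
    refine tsum_congr fun k => ?_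
    rw [Tterm, Tterm, e2_congr (a := u + 1 + k * τ) (b := u + k * τ) 1 (by push_cast; ring)]
  rw [Jfun, Jfun, this, show -(u + 1) / 2 = (-u / 2 + 1 / 2) + (-1 : ℤ) by push_cast; ring, e2_add_int,
    e2_add, e2_half]
  ring

lemma Jfun_add_tau (τ u : ℂ) (hτ : 0 < τ.im) (hu : OffL τ u) :
    Jfun τ (u + τ) = -e2 (u + τ / 2) * Jfun τ u := by
  have : Tfun τ (u + τ) 0 = e2 (1 / 2 + τ) * Tfun τ u 1 := by
    rw [Tfun, Tfun, ← (Equiv.subRight (1 : ℤ)).tsum_eq, ← tsum_mul_left]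
    refine tsum_congr fun k => ?_
    rw [Tterm, Tterm, mul_div_assoc', ← e2_add, Equiv.subRight_apply]
    congr 1
    · refine e2_congr (-1) ?_
      push_cast; ring
    · congr 2; push_cast; ring
  rw [Jfun, this, Tfun_eq τ u hτ hu 1, Jfun, neg_eq_neg_one_mul (e2 (u + τ / 2)), ← e2_half]
  simp only [← mul_assoc, ← e2_add]
  congr 2; push_cast; ring

/-! ### Analyticity of `J` -/

lemma Tfun_split (τ : ℂ) (hτ : 0 < τ.im) (A : ℝ) :
    ∃ F : Finset ℤ, 0 ∈ F ∧ ∃ R : ℂ → ℂ, DifferentiableOn ℂ R {u : ℂ | |u.im| < A} ∧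
      ∀ u : ℂ, |u.im| < A → Tfun τ u 0 = ∑ k ∈ F, Tterm τ u 0 k + R u := by
  obtain ⟨F, h0F, hF⟩ := inv_bound_large τ hτ A
  refine ⟨F, h0F, fun u => ∑' k : ℤ, if k ∈ F then 0 else Tterm τ u 0 k, ?_, ?_⟩
  · refine differentiableOn_tsum_of_summable_norm
      (u := fun k : ℤ => ‖e2 ((k : ℂ) / 2 + ((k : ℂ) * (k - 1) / 2 - k * (0 : ℤ)) * τ)‖ * 2)
      ((summable_Tnum τ hτ 0).norm.mul_right 2) ?_ ?_ ?_
    · intro k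
      by_cases hk : k ∈ F
      · simp only [hk, if_true]; exact differentiableOn_const 0
      · simp only [hk, if_false]
        intro u hu
        apply DifferentiableAt.differentiableWithinAt
        unfold Tterm
        have := (hF k hk u hu).1
        fun_prop (disch := assumption)
    · exact isOpen_lt (by fun_prop) (by fun_prop)
    · intro k u hu
      by_cases hk : k ∈ F
      · simp only [hk, if_true, norm_zero]; positivity
      · simp only [hk, if_false]
        rw [Tterm, div_eq_mul_inv, norm_mul]
        exact mul_le_mul_of_nonneg_left (hF k hk u hu).2 (norm_nonneg _)
  · intro u hu
    have hs := summable_Tterm τ u hτ 0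
    have h1 : Summable fun k : ℤ => if k ∈ F then Tterm τ u 0 k else 0 :=
      summable_of_ne_finset_zero (s := F) (by intro b hb; simp [hb])
    have h2 : Summable fun k : ℤ => if k ∈ F then 0 else Tterm τ u 0 k := by
      refine (hs.sub h1).congr fun k => ?_
      by_cases hk : k ∈ F <;> simp [hk]
    have h3 : ∑' k : ℤ, (if k ∈ F then Tterm τ u 0 k else 0) = ∑ k ∈ F, Tterm τ u 0 k := by
      rw [tsum_eq_sum (s := F) (by intro b hb; simp [hb])]
      exact Finset.sum_congr rfl fun k hk => by simp [hk]
    rw [← h3, ← h1.tsum_add h2, Tfun]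
    refine tsum_congr fun k => ?_
    by_cases hk : k ∈ F <;> simp [hk]

lemma Tterm_differentiableAt (τ u : ℂ) (s k : ℤ) (h : 1 - e2 (u + k * τ) ≠ 0) :
    DifferentiableAt ℂ (fun u => Tterm τ u s k) u := by
  unfold Tterm
  fun_prop (disch := assumption)

lemma strip_mem_nhds (u : ℂ) : {v : ℂ | |v.im| < |u.im| + 1} ∈ nhds u :=
  (isOpen_lt (by fun_prop) (by fun_prop)).mem_nhds (by simp)

lemma Jfun_differentiableAt (τ u : ℂ) (hτ : 0 < τ.im) (hu : OffL τ u) :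
    DifferentiableAt ℂ (Jfun τ) u := by
  obtain ⟨F, -, R, hR, hT⟩ := Tfun_split τ hτ (|u.im| + 1)
  have hn := strip_mem_nhds u
  have h1 : DifferentiableAt ℂ (fun v => Tfun τ v 0) u := by
    have h2 : DifferentiableAt ℂ (fun v => ∑ k ∈ F, Tterm τ v 0 k + R v) u := by
      refine DifferentiableAt.add ?_ (hR.differentiableAt hn)
      exact DifferentiableAt.fun_sum fun k _ => Tterm_differentiableAt τ u 0 k (hu.ne k)
    refine h2.congr_of_eventuallyEq ?_
    filter_upwards [hn] with v hv using hT v hv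
  unfold Jfun
  fun_prop

/-- `u J(τ,u) → -1/(2πi)` as `u → 0`. -/
lemma Jfun_residue (τ : ℂ) (hτ : 0 < τ.im) :
    Filter.Tendsto (fun u => u * Jfun τ u) (nhdsWithin 0 {0}ᶜ)
      (nhds (-(2 * (Real.pi : ℂ) * I)⁻¹)) := by
  obtain ⟨F, h0F, R, hR, hT⟩ := Tfun_split τ hτ (|(0 : ℂ).im| + 1)
  have hn := strip_mem_nhds 0
  have hsl : Filter.Tendsto (fun u => u * (1 - e2 u)⁻¹) (nhdsWithin 0 {0}ᶜ)
      (nhds (-(2 * (Real.pi : ℂ) * I)⁻¹)) := by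
    have h := (hasDerivAt_iff_tendsto_slope.1 hasDerivAt_e2_zero)
    have h2 := (h.inv₀ Complex.two_pi_I_ne_zero).neg
    refine h2.congr' ?_
    filter_upwards [self_mem_nhdsWithin] with u hu
    rw [slope_def_field, e2_zero, sub_zero, inv_div, ← neg_sub (1 : ℂ) (e2 u)]
    rw [div_neg, neg_neg, div_eq_mul_inv]
  have hc : ContinuousAt (fun u => ∑ k ∈ F.erase 0, Tterm τ u 0 k + R u) 0 := by
    refine ContinuousAt.add ?_ (hR.differentiableAt hn).continuousAt
    refine (DifferentiableAt.fun_sum fun k hk => Tterm_differentiableAt τ 0 0 k ?_).continuousAt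
    intro h0
    obtain ⟨a, ha⟩ := (e2_eq_one_iff _).1 (sub_eq_zero.1 h0).symm
    have him := congrArg Complex.im ha
    simp at him
    rcases him with h | h
    · exact (Finset.ne_of_mem_erase hk) h
    · exact hτ.ne' h
  have hz : Filter.Tendsto (fun u : ℂ => u) (nhdsWithin 0 {0}ᶜ) (nhds 0) :=
    Filter.tendsto_id.mono_left nhdsWithin_le_nhds
  have he : Filter.Tendsto (fun u : ℂ => e2 (-u / 2)) (nhdsWithin 0 {0}ᶜ) (nhds 1) := by
    have : ContinuousAt (fun u : ℂ => e2 (-u / 2)) 0 :=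
      (show Differentiable ℂ (fun u : ℂ => e2 (-u / 2)) by fun_prop).continuous.continuousAt
    have h := this.tendsto
    simp only [neg_zero, zero_div, e2_zero] at h
    exact h.mono_left nhdsWithin_le_nhds
  have hfin := he.mul (hsl.add (hz.mul (hc.tendsto.mono_left nhdsWithin_le_nhds)))
  simp only [zero_mul, add_zero, one_mul] at hfin
  refine hfin.congr' ?_
  filter_upwards [nhdsWithin_le_nhds hn] with u hu
  rw [Jfun, hT u hu, ← Finset.add_sum_erase _ _ h0F]
  have : Tterm τ u 0 0 = (1 - e2 u)⁻¹ := by simp [Tterm, e2_zero]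
  rw [this]; ring

/-! ### Modular transformation of `J` -/

lemma tau_ne {τ : ℂ} (hτ : 0 < τ.im) : τ ≠ 0 := by rintro rfl; simp at hτ

lemma S_im {τ : ℂ} (hτ : 0 < τ.im) : 0 < (-1 / τ).im := by
  have := UpperHalfPlane.im_inv_neg_coe_pos ⟨τ, hτ⟩
  have h2 : (-1 / τ) = (-τ)⁻¹ := by
    rw [neg_div, one_div, inv_neg]
  rw [h2]; exact this

lemma OffL.S {τ u : ℂ} (hτ : 0 < τ.im) (h : OffL τ u) : OffL (-1 / τ) (u / τ) := by
  intro a b hab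
  have h0 := tau_ne hτ
  refine h (-b) a ?_
  rw [div_eq_iff h0] at hab
  rw [hab]; push_cast; field_simp; ring

lemma OffL.add {τ u : ℂ} (h : OffL τ u) (a b : ℤ) : OffL τ (u + a + b * τ) := by
  intro c d hcd
  refine h (c - a) (d - b) ?_
  push_cast; linear_combination hcd

def Dfun (τ u : ℂ) : ℂ := e2 (u ^ 2 / (2 * τ)) * Jfun (-1 / τ) (u / τ) - τ * Jfun τ u

lemma Dfun_add_one (τ u : ℂ) (hτ : 0 < τ.im) (hu : OffL τ u) : Dfun τ (u + 1) = -Dfun τ u := by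
  have h0 := tau_ne hτ
  have h1 : OffL (-1 / τ) (u / τ - -1 / τ) := by
    have := (hu.S hτ).add 0 (-1)
    convert this using 1
    push_cast; ring
  have h2 := Jfun_add_tau (-1 / τ) (u / τ - -1 / τ) (S_im hτ) h1
  rw [sub_add_cancel] at h2
  have h3 : (u + 1) / τ = u / τ - -1 / τ := by ring
  rw [Dfun, Dfun, Jfun_add_one, h3, h2]
  have h4 : e2 ((u + 1) ^ 2 / (2 * τ)) =
      e2 (u ^ 2 / (2 * τ)) * e2 (u / τ - -1 / τ + -1 / τ / 2) := by
    rw [← e2_add]; congr 1; field_simp; ring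
  rw [h4]; ring

lemma Dfun_add_tau (τ u : ℂ) (hτ : 0 < τ.im) (hu : OffL τ u) :
    Dfun τ (u + τ) = -e2 (u + τ / 2) * Dfun τ u := by
  have h0 := tau_ne hτ
  have h3 : (u + τ) / τ = u / τ + 1 := by field_simp
  rw [Dfun, Dfun, Jfun_add_tau τ u hτ hu, h3, Jfun_add_one]
  have h4 : e2 ((u + τ) ^ 2 / (2 * τ)) = e2 (u ^ 2 / (2 * τ)) * e2 (u + τ / 2) := by
    rw [← e2_add]; congr 1; field_simp; ring
  rw [h4]; ring

lemma Dfun_add_int (τ u : ℂ) (hτ : 0 < τ.im) (hu : OffL τ u) (a : ℤ) :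
    Dfun τ (u + a) = e2 (a / 2) * Dfun τ u := by
  have hoff : ∀ a : ℤ, OffL τ (u + a) := fun a => by simpa using hu.add a 0
  induction a using Int.induction_on with
  | zero => simp [e2_zero]
  | succ i ih =>
    have := Dfun_add_one τ _ hτ (hoff i)
    push_cast at *
    rw [← add_assoc, this, ih, add_div, e2_add, e2_half]; ring
  | pred i ih =>
    have := Dfun_add_one τ _ hτ (hoff (-(i : ℤ) - 1))
    push_cast at *
    rw [show u + (-(i : ℂ) - 1) + 1 = u + -i by ring, ih] at this
    rw [sub_div, sub_eq_add_neg (-(i : ℂ) / 2), e2_add, e2_neg, e2_half]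
    have h5 : e2 (-(i : ℂ) / 2) * (-1)⁻¹ * Dfun τ u = -(e2 (-(i : ℂ) / 2) * Dfun τ u) := by norm_num
    rw [h5]
    linear_combination this

lemma Dfun_add_lattice (τ u : ℂ) (hτ : 0 < τ.im) (hu : OffL τ u) (a b : ℤ) :
    Dfun τ (u + a + b * τ) = e2 (a / 2 + b / 2 + b * (u + a) + b ^ 2 * τ / 2) * Dfun τ u := by
  have hoff : ∀ b : ℤ, OffL τ (u + a + b * τ) := fun b => hu.add a b
  induction b using Int.induction_on with
  | zero => simpa using Dfun_add_int τ u hτ hu a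
  | succ i ih =>
    have := Dfun_add_tau τ _ hτ (hoff i)
    push_cast at *
    rw [show u + a + ((i : ℂ) + 1) * τ = u + a + i * τ + τ by ring, this, ih, neg_eq_neg_one_mul,
      ← e2_half, ← mul_assoc, ← e2_add, ← e2_add]
    congr 2; ring
  | pred i ih =>
    have := Dfun_add_tau τ _ hτ (hoff (-(i : ℤ) - 1))
    push_cast at *
    rw [show u + a + (-(i : ℂ) - 1) * τ + τ = u + a + -i * τ by ring, ih,
      neg_eq_neg_one_mul (e2 (_ + τ / 2)), ← e2_half, ← e2_add] at this
    apply mul_left_cancel₀ (e2_ne_zero (1 / 2 + (u + ↑a + (-(i : ℂ) - 1) * τ + τ / 2)))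
    rw [← this, ← mul_assoc, ← e2_add]
    congr 1
    refine e2_congr 0 ?_
    push_cast; ring

lemma Dfun_differentiableAt (τ u : ℂ) (hτ : 0 < τ.im) (hu : OffL τ u) :
    DifferentiableAt ℂ (Dfun τ) u := by
  have h0 := tau_ne hτ
  have h1 := Jfun_differentiableAt τ u hτ hu
  have h2 : DifferentiableAt ℂ (fun v => Jfun (-1 / τ) (v / τ)) u := by
    have h3 := Jfun_differentiableAt (-1 / τ) (u / τ) (S_im hτ) (hu.S hτ)
    exact DifferentiableAt.comp (g := Jfun (-1 / τ)) (f := fun v : ℂ => v / τ) u h3 (by fun_prop)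
  unfold Dfun
  fun_prop

lemma Dfun_residue_zero (τ : ℂ) (hτ : 0 < τ.im) :
    Filter.Tendsto (fun u => u * Dfun τ u) (nhdsWithin 0 {0}ᶜ) (nhds 0) := by
  have h0 := tau_ne hτ
  have h1 := Jfun_residue τ hτ
  have h2 := Jfun_residue (-1 / τ) (S_im hτ)
  have h3 : Filter.Tendsto (fun u : ℂ => u / τ) (nhdsWithin 0 {0}ᶜ) (nhdsWithin 0 {0}ᶜ) := by
    refine tendsto_nhdsWithin_iff.2 ⟨?_, ?_⟩
    · have : ContinuousAt (fun u : ℂ => u / τ) 0 := by fun_prop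
      have h := this.tendsto
      rw [zero_div] at h
      exact h.mono_left nhdsWithin_le_nhds
    · filter_upwards [self_mem_nhdsWithin] with u hu
      exact div_ne_zero hu h0
  have h4 := h2.comp h3
  have he : Filter.Tendsto (fun u : ℂ => e2 (u ^ 2 / (2 * τ))) (nhdsWithin 0 {0}ᶜ) (nhds 1) := by
    have : ContinuousAt (fun u : ℂ => e2 (u ^ 2 / (2 * τ))) 0 :=
      (show Differentiable ℂ (fun u : ℂ => e2 (u ^ 2 / (2 * τ))) by fun_prop).continuous.continuousAt
    have h := this.tendsto
    simp only [ne_eq, OfNat.ofNat_ne_zero, not_false_eq_true, zero_pow, zero_div, e2_zero] at h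
    exact h.mono_left nhdsWithin_le_nhds
  have h5 := ((he.mul h4).const_mul τ).sub (h1.const_mul τ)
  rw [one_mul, sub_self] at h5
  refine h5.congr fun u => ?_
  simp only [Function.comp, Dfun]
  field_simp

lemma lattice_isolated (τ : ℂ) (hτ : 0 < τ.im) : ∀ᶠ u in nhdsWithin (0 : ℂ) {0}ᶜ, OffL τ u := by
  have h1 : ∀ᶠ u in nhds (0 : ℂ), |u.im| < τ.im ∧ |u.re| < 1 :=
    ((isOpen_lt (by fun_prop : Continuous fun u : ℂ => |u.im|) (by fun_prop)).inter
      (isOpen_lt (by fun_prop : Continuous fun u : ℂ => |u.re|) (by fun_prop))).mem_nhds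
      (by simp [hτ])
  filter_upwards [nhdsWithin_le_nhds h1, self_mem_nhdsWithin] with u hu hu0 a b hab
  have him : u.im = b * τ.im := by rw [hab]; simp
  have hb : b = 0 := by
    by_contra hb
    have : (1 : ℝ) ≤ |(b : ℝ)| := by exact_mod_cast Int.one_le_abs hb
    have h2 := hu.1
    rw [him, abs_mul, abs_of_pos hτ] at h2
    nlinarith
  subst hb
  have hre : u.re = a := by rw [hab]; simp
  have ha : a = 0 := by
    by_contra ha
    have : (1 : ℝ) ≤ |(a : ℝ)| := by exact_mod_cast Int.one_le_abs ha
    have h2 := hu.2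
    rw [hre] at h2
    linarith
  subst ha
  apply hu0
  simpa using hab

/-- Translate a punctured-neighbourhood statement at a lattice point to `0`. -/
lemma tendsto_sub_punctured (c : ℂ) :
    Filter.Tendsto (fun v : ℂ => v - c) (nhdsWithin c {c}ᶜ) (nhdsWithin 0 {0}ᶜ) := by
  refine tendsto_nhdsWithin_iff.2 ⟨?_, ?_⟩
  · have : ContinuousAt (fun v : ℂ => v - c) c := by fun_prop
    have h := this.tendsto
    rw [sub_self] at h
    exact h.mono_left nhdsWithin_le_nhds
  · filter_upwards [self_mem_nhdsWithin] with u hu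
    exact sub_ne_zero.2 hu

/-- the extension of `D` across the lattice -/
def Dext (τ u : ℂ) : ℂ := Filter.limUnder (nhdsWithin u {u}ᶜ) (Dfun τ)

lemma Dext_eq (τ u : ℂ) (hτ : 0 < τ.im) (hu : OffL τ u) : Dext τ u = Dfun τ u :=
  ((Dfun_differentiableAt τ u hτ hu).continuousAt.tendsto.mono_left nhdsWithin_le_nhds).limUnder_eq

lemma isolated_all (τ c : ℂ) (hτ : 0 < τ.im) (hc : ¬ OffL τ c) :
    ∃ a b : ℤ, c = a + b * τ ∧ (∀ᶠ v in nhdsWithin c {c}ᶜ, OffL τ (v - c) ∧ OffL τ v) := by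
  unfold OffL at hc
  push Not at hc
  obtain ⟨a, b, hab⟩ := hc
  refine ⟨a, b, hab, ?_⟩
  filter_upwards [(tendsto_sub_punctured c).eventually (lattice_isolated τ hτ)] with v hv
  refine ⟨hv, ?_⟩
  have := hv.add a b
  rwa [add_assoc, ← hab, sub_add_cancel] at this

lemma Dfun_residue_lattice (τ c : ℂ) (hτ : 0 < τ.im) (hc : ¬ OffL τ c) :
    Filter.Tendsto (fun v => (v - c) * Dfun τ v) (nhdsWithin c {c}ᶜ) (nhds 0) := by
  obtain ⟨a, b, hab, hev⟩ := isolated_all τ c hτ hc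
  have h1 := (Dfun_residue_zero τ hτ).comp (tendsto_sub_punctured c)
  have hd : Differentiable ℂ (fun v : ℂ =>
    e2 ((a : ℂ) / 2 + b / 2 + b * (v - c + a) + b ^ 2 * τ / 2)) := by fun_prop
  have h2 := (hd.continuous.tendsto c).mono_left
    (nhdsWithin_le_nhds (a := c) (s := {c}ᶜ))
  have h3 := h2.mul h1
  rw [mul_zero] at h3
  refine h3.congr' ?_
  filter_upwards [hev] with v hv
  have := Dfun_add_lattice τ (v - c) hτ hv.1 a b
  rw [add_assoc (v - c), ← hab, sub_add_cancel] at this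
  rw [this]
  simp only [Function.comp]
  ring

lemma OffL.eventually {τ c : ℂ} (hτ : 0 < τ.im) (hc : OffL τ c) : ∀ᶠ v in nhds c, OffL τ v := by
  obtain ⟨F, -, hF⟩ := inv_bound_large τ hτ (|c.im| + 1)
  have h1 : ∀ᶠ v in nhds c, ∀ k ∈ F, 1 - e2 (v + k * τ) ≠ 0 := by
    rw [Filter.eventually_all_finset]
    intro k _
    have hd : Differentiable ℂ fun v : ℂ => 1 - e2 (v + k * τ) := by fun_prop
    exact hd.continuous.continuousAt.eventually_ne (hc.ne k)
  filter_upwards [h1, strip_mem_nhds c] with v hv hv2 a b hab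
  have h3 : 1 - e2 (v + (-b : ℤ) * τ) ≠ 0 := by
    by_cases hb : -b ∈ F
    · exact hv _ hb
    · exact (hF _ hb v hv2).1
  apply h3
  rw [e2_congr (b := 0) a (by rw [hab]; push_cast; ring), e2_zero, sub_self]

lemma Dext_differentiable (τ : ℂ) (hτ : 0 < τ.im) : Differentiable ℂ (Dext τ) := by
  intro c
  by_cases hc : OffL τ c
  · have hev : ∀ᶠ v in nhds c, OffL τ v := by
      exact OffL.eventually hτ hc
    refine (Dfun_differentiableAt τ c hτ hc).congr_of_eventuallyEq ?_
    filter_upwards [hev] with v hv using Dext_eq τ v hτ hv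
  · obtain ⟨a, b, hab, hev⟩ := isolated_all τ c hτ hc
    rw [eventually_nhdsWithin_iff] at hev
    have hdd : DifferentiableOn ℂ (Function.update (Dfun τ) c (Filter.limUnder (nhdsWithin c {c}ᶜ) (Dfun τ)))
        {v | v ∈ ({c}ᶜ : Set ℂ) → OffL τ (v - c) ∧ OffL τ v} := by
      refine Complex.differentiableOn_update_limUnder_of_isLittleO hev ?_ ?_
      · intro v hv
        exact (Dfun_differentiableAt τ v hτ (hv.1 hv.2).2).differentiableWithinAt
      · have h1 := Dfun_residue_lattice τ c hτ hc
        have h2 : Filter.Tendsto (fun v => (v - c) * Dfun τ c) (nhdsWithin c {c}ᶜ) (nhds 0) := by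
          have : ContinuousAt (fun v : ℂ => (v - c) * Dfun τ c) c := by fun_prop
          have h := this.tendsto
          rw [sub_self, zero_mul] at h
          exact h.mono_left nhdsWithin_le_nhds
        have h3 := h1.sub h2
        rw [sub_zero] at h3
        rw [Asymptotics.isLittleO_iff_tendsto']
        · refine h3.congr fun v => ?_
          rw [div_inv_eq_mul]; ring
        · filter_upwards [self_mem_nhdsWithin] with v hv h0
          exact absurd (inv_eq_zero.1 h0) (sub_ne_zero.2 hv)
    refine (hdd.differentiableAt hev).congr_of_eventuallyEq ?_
    filter_upwards [hev] with v hv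
    by_cases hvc : v = c
    · subst hvc; simp [Dext]
    · rw [Function.update_of_ne hvc]
      exact Dext_eq τ v hτ (hv hvc).2

lemma dense_offL (τ : ℂ) : Dense {u : ℂ | OffL τ u} := by
  have h : (Set.range fun p : ℤ × ℤ => (p.1 : ℂ) + p.2 * τ).Countable := Set.countable_range _
  refine (h.dense_compl ℝ).mono ?_
  intro u hu a b hab
  exact hu ⟨(a, b), hab.symm⟩

/-- Reduction of a point modulo the lattice. -/
lemma reduce_lattice (τ u : ℂ) (hτ : 0 < τ.im) :
    ∃ a b : ℤ, 0 ≤ (u - a - b * τ).im ∧ (u - a - b * τ).im ≤ τ.im ∧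
      ‖u - a - b * τ‖ ≤ 1 + ‖τ‖ := by
  set y := u.im / τ.im with hy
  set x := u.re - y * τ.re with hx
  have hu : u = x + y * τ := by
    apply Complex.ext
    · simp [hx]
    · simp [hy, hτ.ne']
  have key : u - (⌊x⌋ : ℤ) - (⌊y⌋ : ℤ) * τ = (Int.fract x : ℝ) + (Int.fract y : ℝ) * τ := by
    rw [hu, Int.fract, Int.fract]; push_cast; ring
  refine ⟨⌊x⌋, ⌊y⌋, ?_, ?_, ?_⟩
  · rw [key]; simp [mul_nonneg (Int.fract_nonneg y) hτ.le]
  · rw [key]; simp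
    have := (Int.fract_lt_one y).le
    nlinarith
  · rw [key]
    refine (norm_add_le _ _).trans ?_
    rw [norm_mul, Complex.norm_real, Complex.norm_real, Real.norm_of_nonneg (Int.fract_nonneg x),
      Real.norm_of_nonneg (Int.fract_nonneg y)]
    have h1 := (Int.fract_lt_one x).le
    have h2 := (Int.fract_lt_one y).le
    have h3 := norm_nonneg τ
    nlinarith

lemma Dext_bounded (τ : ℂ) (hτ : 0 < τ.im) : ∃ C : ℝ, ∀ u, ‖Dext τ u‖ ≤ C := by
  have hcont := (Dext_differentiable τ hτ).continuous
  obtain ⟨C, hC⟩ := (isCompact_closedBall (0 : ℂ) (1 + ‖τ‖)).exists_bound_of_continuousOn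
    hcont.continuousOn
  have hoff : ∀ u, OffL τ u → ‖Dext τ u‖ ≤ Real.exp (Real.pi * τ.im) * C := by
    intro u hu
    obtain ⟨a, b, h1, h2, h3⟩ := reduce_lattice τ u hτ
    set v := u - a - b * τ with hv
    have hvo : OffL τ v := by
      have := hu.add (-a) (-b)
      convert this using 1
      rw [hv]; push_cast; ring
    have huv : u = v + a + b * τ := by rw [hv]; ring
    rw [Dext_eq τ u hτ hu, huv, Dfun_add_lattice τ v hτ hvo a b, norm_mul, norm_e2]
    have hb1 := hC v (by simpa using h3)
    rw [Dext_eq τ v hτ hvo] at hb1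
    have him : ((a : ℂ) / 2 + b / 2 + b * (v + a) + b ^ 2 * τ / 2).im =
        b * v.im + b ^ 2 * τ.im / 2 := by
      have : ((a : ℂ) / 2 + b / 2 + b * (v + a) + b ^ 2 * τ / 2) =
        ((a / 2 + b / 2 + b * a : ℝ) : ℂ) + ((b : ℝ) : ℂ) * v + ((b ^ 2 / 2 : ℝ) : ℂ) * τ := by
        push_cast; ring
      rw [this]
      simp only [Complex.add_im, Complex.im_ofReal_mul, Complex.ofReal_im]
      ring
    refine mul_le_mul (Real.exp_le_exp.2 ?_) hb1 (norm_nonneg _) (Real.exp_pos _).le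
    rw [him]
    have hq : -(τ.im / 2) ≤ b * v.im + b ^ 2 * τ.im / 2 := by
      rcases le_or_gt 0 b with hb | hb
      · have : (0 : ℝ) ≤ b := by exact_mod_cast hb
        have h5 : 0 ≤ (b : ℝ) * v.im := mul_nonneg this h1
        have h6 : 0 ≤ (b : ℝ) ^ 2 * τ.im := mul_nonneg (sq_nonneg _) hτ.le
        linarith
      · have : (b : ℝ) < 0 := by exact_mod_cast hb
        have h5 : (b : ℝ) * τ.im ≤ b * v.im := mul_le_mul_of_nonpos_left h2 this.le
        nlinarith [mul_nonneg (sq_nonneg ((b : ℝ) + 1)) hτ.le]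
    have := Real.pi_pos
    nlinarith
  refine ⟨Real.exp (Real.pi * τ.im) * C, fun u => ?_⟩
  have hcl : IsClosed {u : ℂ | ‖Dext τ u‖ ≤ Real.exp (Real.pi * τ.im) * C} :=
    isClosed_le hcont.norm continuous_const
  have hsub : {u : ℂ | OffL τ u} ⊆ {u : ℂ | ‖Dext τ u‖ ≤ Real.exp (Real.pi * τ.im) * C} :=
    fun u hu => hoff u hu
  have := hcl.closure_subset_iff.2 hsub
  rw [(dense_offL τ).closure_eq] at this
  exact this (Set.mem_univ u)

lemma Dfun_eq_zero (τ u : ℂ) (hτ : 0 < τ.im) (hu : OffL τ u) : Dfun τ u = 0 := by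
  obtain ⟨C, hC⟩ := Dext_bounded τ hτ
  have hb : Bornology.IsBounded (Set.range (Dext τ)) := by
    rw [isBounded_iff_forall_norm_le]
    exact ⟨C, by rintro _ ⟨v, rfl⟩; exact hC v⟩
  have h1 := (Dext_differentiable τ hτ).apply_eq_apply_of_bounded hb (u + 1) u
  have hu1 : OffL τ (u + 1) := by simpa using hu.add 1 0
  rw [Dext_eq τ u hτ hu, Dext_eq τ _ hτ hu1, Dfun_add_one τ u hτ hu] at h1
  exact self_eq_neg.1 h1.symm

/-- Modular transformation of `J`. -/
lemma Jfun_S (τ u : ℂ) (hτ : 0 < τ.im) (hu : OffL τ u) :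
    Jfun (-1 / τ) (u / τ) = τ * e2 (-(u ^ 2 / (2 * τ))) * Jfun τ u := by
  have h := Dfun_eq_zero τ u hτ hu
  rw [Dfun, sub_eq_zero] at h
  rw [e2_neg]
  have := e2_ne_zero (u ^ 2 / (2 * τ))
  apply mul_left_cancel₀ this
  rw [h]
  generalize e2 (u ^ 2 / (2 * τ)) = E at this
  field_simp

/-! ### The functions `H_n(p)` -/

def Hterm (M : ℕ) (n : ℤ) (τ z : ℂ) (p k : ℤ) : ℂ :=
  e2 (((M : ℂ) * (k - p) + n) * z / 2 + ((M : ℂ) / 2 * k ^ 2 - M * k * p + n * k) * τ) /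
    (1 - e2 ((M : ℂ) / 2 * z + k * (M * τ)))

def Hfun (M : ℕ) (n : ℤ) (τ z : ℂ) (p : ℤ) : ℂ := ∑' k : ℤ, Hterm M n τ z p k

lemma Mtau_im {M : ℕ} (hM : 0 < M) {τ : ℂ} (hτ : 0 < τ.im) : 0 < ((M : ℂ) * τ).im := by
  have : (0 : ℝ) < M := by exact_mod_cast hM
  simpa using mul_pos this hτ

lemma summable_Hnum (M : ℕ) (hM : 0 < M) (n : ℤ) (τ z : ℂ) (hτ : 0 < τ.im) (p : ℤ) :
    Summable fun k : ℤ => e2 (((M : ℂ) * (k - p) + n) * z / 2 +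
      ((M : ℂ) / 2 * k ^ 2 - M * k * p + n * k) * τ) := by
  have h : 0 < ((M : ℂ) * τ / 2).im := by simpa using Mtau_im hM hτ
  refine (summable_gauss ((M : ℂ) * τ / 2) (M * z / 2 - M * p * τ + n * τ)
    ((-M * p + n) * z / 2) h).congr fun k => ?_
  congr 1; ring

lemma summable_Hterm (M : ℕ) (hM : 0 < M) (n : ℤ) (τ z : ℂ) (hτ : 0 < τ.im) (p : ℤ) :
    Summable (Hterm M n τ z p) :=
  summable_div _ (summable_Hnum M hM n τ z hτ p) (fun k => k) _ (Mtau_im hM hτ) _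

/-- nonvanishing of the denominators of `h` -/
def OffH (M : ℕ) (τ z : ℂ) : Prop := ∀ k : ℤ, 1 - e2 ((M : ℂ) / 2 * z + k * (M * τ)) ≠ 0

lemma hfun_eq (M : ℕ) (n ν : ℤ) (τ z : ℂ) :
    e2 (-((M : ℂ) / 2 * (ν : ℂ) ^ 2) * τ) * hfun ((M : ℂ) / 2) n ν τ z = Hfun M n τ z ν := by
  rw [hfun, Hfun, ← tsum_mul_left, ← (Equiv.subRight ν).tsum_eq]
  refine tsum_congr fun k => ?_
  rw [Hterm, mul_div_assoc', ← e2_add, Equiv.subRight_apply]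
  congr 1
  · congr 1; push_cast; ring
  · congr 2; push_cast; ring

lemma Hfun_rec (M : ℕ) (hM : 0 < M) (n : ℤ) (τ z : ℂ) (hτ : 0 < τ.im) (hz : OffH M τ z) (p : ℤ) :
    Hfun M n τ z (p + 1) = Hfun M n τ z p +
      e2 (-((M : ℂ) / 2 * ((p + 1 : ℤ) - (n : ℂ) / M) ^ 2) * τ) *
        jtheta 1 n ((M : ℂ) / 2) τ z := by
  have hM0 : (M : ℂ) ≠ 0 := by exact_mod_cast hM.ne'
  rw [← sub_eq_iff_eq_add', Hfun, Hfun,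
    ← (summable_Hterm M hM n τ z hτ (p + 1)).tsum_sub (summable_Hterm M hM n τ z hτ p), jtheta,
    ← tsum_mul_left, ← (Equiv.addRight (p + 1)).tsum_eq]
  refine tsum_congr fun k => ?_
  have h0 := hz (k + (p + 1))
  rw [Equiv.coe_addRight, Hterm, Hterm, ← sub_div, div_eq_iff h0, one_zpow, one_mul, ← e2_add,
    mul_sub (e2 _) 1, mul_one, ← e2_add]
  congr 2
  · push_cast; field_simp; ring
  · push_cast; field_simp; ring

/-- inner finite sums of the indefinite double sum -/
def sterm (a : ℤ → ℂ) (j p : ℤ) : ℂ :=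
  (if 0 < p ∧ p ≤ j then a p else 0) - (if j < p ∧ p ≤ 0 then a p else 0)

lemma summable_sterm (a : ℤ → ℂ) (j : ℤ) : Summable (sterm a j) := by
  refine summable_of_ne_finset_zero (s := Finset.Icc (-|j|) |j|) fun p hp => ?_
  have h := abs_le.1 (le_refl |j|)
  rw [Finset.mem_Icc] at hp
  rw [sterm, if_neg (by omega), if_neg (by omega), sub_zero]

lemma tsum_sterm_zero (a : ℤ → ℂ) : ∑' p, sterm a 0 p = 0 := by
  have h : ∀ p, sterm a 0 p = 0 := fun p => by
    rw [sterm, if_neg (by omega), sub_zero]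
  simp [h]

lemma tsum_sterm_succ (a : ℤ → ℂ) (j : ℤ) :
    ∑' p, sterm a (j + 1) p = ∑' p, sterm a j p + a (j + 1) := by
  rw [← sub_eq_iff_eq_add', ← (summable_sterm a (j + 1)).tsum_sub (summable_sterm a j)]
  rw [tsum_eq_single (j + 1)]
  · simp only [sterm]
    by_cases h : 0 < j + 1
    · rw [if_pos (by omega), if_neg (by omega), if_neg (by omega), if_neg (by omega)]; ring
    · rw [if_neg (by omega), if_neg (by omega), if_neg (by omega), if_pos (by omega)]; ring
  · intro p hp
    simp only [sterm]
    have e1 : (0 < p ∧ p ≤ j + 1) ↔ (0 < p ∧ p ≤ j) := by omega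
    have e3 : (j + 1 < p ∧ p ≤ 0) ↔ (j < p ∧ p ≤ 0) := by omega
    simp only [e1, e3, sub_self]

lemma Hfun_shift (M : ℕ) (hM : 0 < M) (n ν : ℤ) (τ z : ℂ) (hτ : 0 < τ.im) (hz : OffH M τ z)
    (j : ℤ) :
    Hfun M n τ z (j + ν) = Hfun M n τ z ν +
      (∑' p, sterm (fun p => e2 (-((M : ℂ) / 2 * ((p : ℂ) + ν - (n : ℂ) / M) ^ 2) * τ)) j p) *
        jtheta 1 n ((M : ℂ) / 2) τ z := by
  induction j using Int.induction_on with
  | zero => rw [tsum_sterm_zero]; simp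
  | succ i ih =>
    rw [show (i : ℤ) + 1 + ν = (i + ν) + 1 by ring, Hfun_rec M hM n τ z hτ hz, ih, tsum_sterm_succ]
    push_cast
    rw [show (i : ℂ) + ν + 1 = i + 1 + ν by ring]; ring
  | pred i ih =>
    have h1 := Hfun_rec M hM n τ z hτ hz (-(i : ℤ) - 1 + ν)
    have h2 := tsum_sterm_succ
      (fun p => e2 (-((M : ℂ) / 2 * ((p : ℂ) + ν - (n : ℂ) / M) ^ 2) * τ)) (-(i : ℤ) - 1)
    rw [show -(i : ℤ) - 1 + ν + 1 = -i + ν by ring, ih] at h1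
    rw [sub_add_cancel] at h2
    rw [h2] at h1
    push_cast at *
    linear_combination -h1

/-! ### Rewriting `G` -/

def cterm (M : ℕ) (ν : ℤ) (τ : ℂ) (j : ℤ) : ℂ :=
  e2 ((j : ℂ) / 2 +
    ((M : ℂ) + 1) / 2 * ((j : ℂ) + ν - ((ν : ℂ) + 1 / 2) / (M + 1)) ^ 2 * τ)

lemma M1_ne (M : ℕ) : (M : ℂ) + 1 ≠ 0 := by exact_mod_cast Nat.succ_ne_zero M

lemma summable_cterm (M : ℕ) (ν : ℤ) (τ : ℂ) (hτ : 0 < τ.im) : Summable (cterm M ν τ) := by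
  have h : 0 < (((M + 1 : ℕ) : ℂ) * τ / 2).im := by
    simpa using Mtau_im (Nat.succ_pos M) hτ
  refine (summable_gauss _
    (1 / 2 + (M + 1) * ((ν : ℂ) - ((ν : ℂ) + 1 / 2) / (M + 1)) * τ)
    ((M + 1) / 2 * ((ν : ℂ) - ((ν : ℂ) + 1 / 2) / (M + 1)) ^ 2 * τ) h).congr fun j => ?_
  rw [cterm]; congr 1; push_cast; ring

lemma tsum_cterm (M : ℕ) (ν : ℤ) (τ : ℂ) :
    (-1 : ℂ) ^ ν * jtheta (-1) ((ν : ℂ) + 1 / 2) ((M : ℂ) / 2 + 1 / 2) τ 0 =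
      ∑' j, cterm M ν τ j := by
  have h0 := M1_ne M
  rw [jtheta, ← tsum_mul_left, ← (Equiv.subLeft (-ν)).tsum_eq]
  refine tsum_congr fun j => ?_
  rw [neg_one_zpow_eq, neg_one_zpow_eq, cterm, ← e2_add, ← e2_add, Equiv.subLeft_apply]
  refine e2_congr (-j) ?_
  have h1 : 2 * ((M : ℂ) / 2 + 1 / 2) = M + 1 := by ring
  rw [h1]
  push_cast; ring

def eqPR : ℤ × ℤ ≃ ℤ × ℤ where
  toFun x := (x.1 + x.2, x.1)
  invFun y := (y.2, y.1 - y.2)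
  left_inv x := by ext <;> simp
  right_inv y := by ext <;> simp

lemma summable_g (M : ℕ) (n ν : ℤ) (τ : ℂ) (hτ : 0 < τ.im) :
    Summable fun x : ℤ × ℤ => cterm M ν τ x.1 *
      sterm (fun p => e2 (-((M : ℂ) / 2 * ((p : ℂ) + ν - (n : ℂ) / M) ^ 2) * τ)) x.1 x.2 := by
  rw [← eqPR.summable_iff]
  set α : ℂ := (ν : ℂ) - ((ν : ℂ) + 1 / 2) / (M + 1) with hα
  set β : ℂ := (ν : ℂ) - (n : ℂ) / M with hβ
  have h1 : 0 < (τ / 2).im := by simpa using hτ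
  have h2 : 0 < (((M + 1 : ℕ) : ℂ) * τ / 2).im := by
    simpa using Mtau_im (Nat.succ_pos M) hτ
  have s1 := summable_gauss (τ / 2) (1 / 2 + (M + 1) * α * τ - M * β * τ)
    ((M + 1) / 2 * α ^ 2 * τ - M / 2 * β ^ 2 * τ) h1
  have s2 := summable_gauss (((M + 1 : ℕ) : ℂ) * τ / 2) (1 / 2 + (M + 1) * α * τ) 0 h2
  have s3 := s1.norm.mul_of_nonneg s2.norm (fun _ => norm_nonneg _) (fun _ => norm_nonneg _)
  refine Summable.of_norm_bounded s3 ?_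
  rintro ⟨p, r⟩
  have hmain : 0 ≤ p * r → ‖cterm M ν τ (p + r) *
      e2 (-((M : ℂ) / 2 * ((p : ℂ) + ν - (n : ℂ) / M) ^ 2) * τ)‖ ≤
      ‖e2 (τ / 2 * (p : ℂ) ^ 2 + (1 / 2 + (M + 1) * α * τ - M * β * τ) * p +
        ((M + 1) / 2 * α ^ 2 * τ - M / 2 * β ^ 2 * τ))‖ *
      ‖e2 (((M + 1 : ℕ) : ℂ) * τ / 2 * (r : ℂ) ^ 2 + (1 / 2 + (M + 1) * α * τ) * r + 0)‖ := by
    intro hpr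
    have : cterm M ν τ (p + r) *
      e2 (-((M : ℂ) / 2 * ((p : ℂ) + ν - (n : ℂ) / M) ^ 2) * τ) =
      e2 (τ / 2 * (p : ℂ) ^ 2 + (1 / 2 + (M + 1) * α * τ - M * β * τ) * p +
        ((M + 1) / 2 * α ^ 2 * τ - M / 2 * β ^ 2 * τ)) *
      e2 (((M + 1 : ℕ) : ℂ) * τ / 2 * (r : ℂ) ^ 2 + (1 / 2 + (M + 1) * α * τ) * r + 0) *
      e2 (((((M : ℝ) + 1) * ((p * r : ℤ) : ℝ) : ℝ) : ℂ) * τ) := by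
      rw [cterm, ← e2_add, ← e2_add, ← e2_add]
      congr 1
      rw [add_sub_assoc, ← hα, add_sub_assoc, ← hβ]
      push_cast; ring
    rw [this, norm_mul, norm_mul]
    refine mul_le_of_le_one_right (by positivity) ?_
    rw [norm_e2, Real.exp_le_one_iff, Complex.im_ofReal_mul]
    have h5 : (0 : ℝ) ≤ ((p * r : ℤ) : ℝ) := by exact_mod_cast hpr
    have := Real.pi_pos
    have : 0 ≤ 2 * Real.pi * (((M : ℝ) + 1) * ((p * r : ℤ) : ℝ) * τ.im) := by positivity
    linarith
  change ‖cterm M ν τ (p + r) * sterm _ (p + r) p‖ ≤ _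
  rw [sterm]
  by_cases hA : 0 < p ∧ p ≤ p + r
  · rw [if_pos hA, if_neg (by omega), sub_zero]
    exact hmain (mul_nonneg (by omega) (by omega))
  · rw [if_neg hA, zero_sub]
    by_cases hB : p + r < p ∧ p ≤ 0
    · rw [if_pos hB, mul_neg, norm_neg]
      exact hmain (mul_nonneg_of_nonpos_of_nonpos (by omega) (by omega))
    · rw [if_neg hB, neg_zero, mul_zero, norm_zero]
      positivity

lemma gfun_eq (M : ℕ) (n ν : ℤ) (τ : ℂ) (hτ : 0 < τ.im) :
    (Summable fun j : ℤ => cterm M ν τ j * ∑' p,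
      sterm (fun p => e2 (-((M : ℂ) / 2 * ((p : ℂ) + ν - (n : ℂ) / M) ^ 2) * τ)) j p) ∧
    gfun ((M : ℂ) / 2) n ν τ = ∑' j : ℤ, cterm M ν τ j * ∑' p,
      sterm (fun p => e2 (-((M : ℂ) / 2 * ((p : ℂ) + ν - (n : ℂ) / M) ^ 2) * τ)) j p := by
  have hs := summable_g M n ν τ hτ
  have h1 := hs.prod
  simp only [tsum_mul_left] at h1
  refine ⟨h1, ?_⟩
  have h2 := hs.tsum_prod
  simp only [tsum_mul_left] at h2
  rw [← h2, gfun, indefSum]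
  refine tsum_congr fun x => ?_
  have h3 : ∀ j p : ℤ, (-1 : ℂ) ^ j *
      e2 ((((M : ℂ) / 2 + 1 / 2) * ((j : ℂ) + (ν : ℂ) - ((ν : ℂ) + 1 / 2) / (2 * ((M : ℂ) / 2) + 1)) ^ 2 -
        (M : ℂ) / 2 * ((p : ℂ) + (ν : ℂ) - (n : ℂ) / (2 * ((M : ℂ) / 2))) ^ 2) * τ) =
      cterm M ν τ j * e2 (-((M : ℂ) / 2 * ((p : ℂ) + ν - (n : ℂ) / M) ^ 2) * τ) := by
    intro j p
    rw [neg_one_zpow_eq, cterm, ← e2_add, ← e2_add, show 2 * ((M : ℂ) / 2) = M by ring]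
    congr 1; ring
  simp only [h3, sterm, mul_sub, mul_ite, mul_zero]

lemma Gfun_eq (M : ℕ) (hM : 0 < M) (n ν : ℤ) (τ z : ℂ) (hτ : 0 < τ.im) (hz : OffH M τ z) :
    Gfun ((M : ℂ) / 2) n ν τ z = ∑' j : ℤ, cterm M ν τ j * Hfun M n τ z (j + ν) := by
  obtain ⟨hs, hg⟩ := gfun_eq M n ν τ hτ
  have hc := summable_cterm M ν τ hτ
  have : Gfun ((M : ℂ) / 2) n ν τ z = gfun ((M : ℂ) / 2) n ν τ * jtheta 1 (n : ℂ) ((M : ℂ) / 2) τ z +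
      ((-1 : ℂ) ^ ν * jtheta (-1) ((ν : ℂ) + 1 / 2) ((M : ℂ) / 2 + 1 / 2) τ 0) *
      (e2 (-((M : ℂ) / 2 * (ν : ℂ) ^ 2) * τ) * hfun ((M : ℂ) / 2) n ν τ z) := by
    rw [Gfun]; ring
  rw [this, hfun_eq, tsum_cterm, hg, ← tsum_mul_right, ← tsum_mul_right,
    ← (hs.mul_right _).tsum_add (hc.mul_right _)]
  refine tsum_congr fun j => ?_
  rw [Hfun_shift M hM n ν τ z hτ hz j]
  ring

def eqLD (ν : ℤ) : ℤ × ℤ ≃ ℤ × ℤ where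
  toFun x := (x.2 - ν, x.1 + x.2)
  invFun y := (y.2 - y.1 - ν, y.1 + ν)
  left_inv x := by ext <;> simp <;> ring
  right_inv y := by ext <;> simp <;> ring

def eqLK (ν : ℤ) : ℤ × ℤ ≃ ℤ × ℤ where
  toFun x := (x.2 - x.1 - ν, x.2)
  invFun y := (y.2 - y.1 - ν, y.2)
  left_inv x := by ext <;> simp <;> ring
  right_inv y := by ext <;> simp <;> ring

lemma summable_cH (M : ℕ) (hM : 0 < M) (n ν : ℤ) (τ z : ℂ) (hτ : 0 < τ.im) :
    Summable fun x : ℤ × ℤ => cterm M ν τ x.1 * Hterm M n τ z (x.1 + ν) x.2 := by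
  have h0 := M1_ne M
  have h1 : 0 < (τ / 2).im := by simpa using hτ
  have h2 : 0 < ((M : ℂ) * τ / 2).im := by simpa using Mtau_im hM hτ
  have s1 := summable_gauss ((M : ℂ) * τ / 2) (M * z / 2 + n * τ) (n * z / 2) h2
  have s2 := summable_gauss (τ / 2) (1 / 2 - (ν + 1 / 2) * τ + n * τ)
    (-ν / 2 + (ν + 1 / 2) ^ 2 / (2 * (M + 1)) * τ) h1
  have s3 := summable_mul_of_summable_norm s1.norm s2.norm
  rw [← (eqLD ν).summable_iff]
  refine (summable_div _ s3 (fun x => x.1 + x.2) ((M : ℂ) * τ) (Mtau_im hM hτ)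
    ((M : ℂ) / 2 * z)).congr ?_
  rintro ⟨l, d⟩
  simp only [Function.comp, eqLD, Equiv.coe_fn_mk, Hterm, cterm]
  rw [mul_div_assoc', ← e2_add, ← e2_add]
  congr 2
  push_cast; field_simp; ring

lemma Gfun_eq2 (M : ℕ) (hM : 0 < M) (n ν : ℤ) (τ z : ℂ) (hτ : 0 < τ.im) (hz : OffH M τ z) :
    Gfun ((M : ℂ) / 2) n ν τ z =
      ∑' x : ℤ × ℤ, cterm M ν τ x.1 * Hterm M n τ z (x.1 + ν) x.2 := by
  rw [Gfun_eq M hM n ν τ z hτ hz, (summable_cH M hM n ν τ z hτ).tsum_prod]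
  refine tsum_congr fun j => ?_
  change _ = ∑' c, cterm M ν τ j * Hterm M n τ z (j + ν) c
  rw [tsum_mul_left, Hfun]

lemma OffH.off {M : ℕ} {τ z : ℂ} (hz : OffH M τ z) : OffL τ (z / 2) := by
  intro a b hab
  apply hz (-b)
  have : z = 2 * (a + b * τ) := by rw [← hab]; ring
  rw [e2_congr (b := 0) (M * a) (by rw [this]; push_cast; ring), e2_zero, sub_self]

lemma geom_aux (M : ℕ) (w : ℂ) (h1 : 1 - e2 w ≠ 0) (h2 : 1 - e2 (M * w) ≠ 0) :
    ∑ n ∈ Finset.range M, e2 (n * w) / (1 - e2 (M * w)) = 1 / (1 - e2 w) := by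
  rw [← Finset.sum_div, div_eq_div_iff h2 h1, one_mul, e2_nat_mul]
  simp only [e2_nat_mul]
  exact geom_sum_mul_neg _ _

/-- The sum of the `G_{n,ν}` over `n` is a product. -/
lemma Gtot_eq (M : ℕ) (hM : 0 < M) (ν : ℤ) (τ z : ℂ) (hτ : 0 < τ.im) (hz : OffH M τ z) :
    ∑ n ∈ Finset.range M, Gfun ((M : ℂ) / 2) (n : ℤ) ν τ z =
      (-1 : ℂ) ^ ν * Jfun τ (z / 2) *
        jtheta (-1) ((ν : ℂ) + 1 / 2) ((M : ℂ) / 2 + 1 / 2) τ z := by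
  have h0 := M1_ne M
  have hu := hz.off
  have hsum : Summable fun x : ℤ × ℤ => ∑ n ∈ Finset.range M,
      cterm M ν τ x.1 * Hterm M (n : ℤ) τ z (x.1 + ν) x.2 :=
    summable_sum fun n _ => summable_cH M hM n ν τ z hτ
  have hG : ∑ n ∈ Finset.range M, Gfun ((M : ℂ) / 2) (n : ℤ) ν τ z =
      ∑' x : ℤ × ℤ, ∑ n ∈ Finset.range M,
        cterm M ν τ x.1 * Hterm M (n : ℤ) τ z (x.1 + ν) x.2 := by
    have h9 := Summable.tsum_finsetSum (s := Finset.range M)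
      (f := fun (n : ℕ) (x : ℤ × ℤ) => cterm M ν τ x.1 * Hterm M (n : ℤ) τ z (x.1 + ν) x.2)
      (fun n _ => summable_cH M hM (n : ℤ) ν τ z hτ)
    rw [h9]
    exact Finset.sum_congr rfl fun n _ => Gfun_eq2 M hM n ν τ z hτ hz
  rw [hG]
  have h8 := (eqLK ν).tsum_eq (fun x : ℤ × ℤ => ∑ n ∈ Finset.range M,
      cterm M ν τ x.1 * Hterm M (n : ℤ) τ z (x.1 + ν) x.2)
  rw [← h8]
  change ∑' x, ((fun x : ℤ × ℤ => ∑ n ∈ Finset.range M,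
      cterm M ν τ x.1 * Hterm M (n : ℤ) τ z (x.1 + ν) x.2) ∘ (eqLK ν)) x = _
  rw [((eqLK ν).summable_iff.2 hsum).tsum_prod, jtheta, ← tsum_mul_left]
  refine tsum_congr fun l => ?_
  have hT := Tfun_eq τ (z / 2) hτ hu (l + ν)
  have hterm : ∀ k : ℤ, ((fun x : ℤ × ℤ => ∑ n ∈ Finset.range M,
      cterm M ν τ x.1 * Hterm M (n : ℤ) τ z (x.1 + ν) x.2) ∘ (eqLK ν)) (l, k) =
      e2 (-(l + ν) / 2 + M * l * z / 2 + (M / 2 * l ^ 2 + l ^ 2 / 2 + (ν + 1 / 2) * l +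
        (ν + 1 / 2) ^ 2 / (2 * (M + 1))) * τ) * Tterm τ (z / 2) (l + ν) k := by
    intro k
    have hg := geom_aux M (z / 2 + k * τ) (hu.ne k) (by
      have := hz k
      rwa [show (M : ℂ) / 2 * z + k * (M * τ) = M * (z / 2 + k * τ) by ring] at this)
    have hT2 : Tterm τ (z / 2) (l + ν) k =
        e2 ((k : ℂ) / 2 + ((k : ℂ) * (k - 1) / 2 - k * (l + ν : ℤ)) * τ) *
        (1 / (1 - e2 (z / 2 + k * τ))) := by rw [Tterm]; ring
    rw [hT2, ← hg, Finset.mul_sum, Finset.mul_sum]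
    simp only [Function.comp, eqLK, Equiv.coe_fn_mk]
    refine Finset.sum_congr rfl fun n _ => ?_
    rw [Hterm, cterm, mul_div_assoc', mul_div_assoc', mul_div_assoc', ← e2_add, ← e2_add, ← e2_add]
    congr 1
    · congr 1
      push_cast; field_simp; ring
    · congr 2; ring
  rw [tsum_congr hterm, tsum_mul_left]
  change _ * Tfun τ (z / 2) (l + ν) = _
  rw [hT, Jfun, neg_one_zpow_eq, neg_one_zpow_eq]
  have h1 : 2 * ((M : ℂ) / 2 + 1 / 2) = M + 1 := by ring
  rw [h1]
  have : ∀ a b c d e f T : ℂ, e2 a = e2 (b + c + d + e - f) →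
      e2 a * (e2 f * T) = e2 b * (e2 c * T) * (e2 d * e2 e) := by
    intro a b c d e f T h
    rw [h, sub_eq_add_neg, e2_add, e2_add, e2_add, e2_add, e2_neg]
    have := e2_ne_zero f
    field_simp
  apply this
  refine e2_congr (-(l + ν)) ?_
  push_cast; field_simp; ring

/-! ### The theta transformation -/

lemma jtheta2_eq (Z σ : ℂ) :
    jacobiTheta₂ Z σ = ∑' r : ℤ, e2 (r * Z + (r : ℂ) ^ 2 * σ / 2) := by
  rw [jacobiTheta₂]
  refine tsum_congr fun r => ?_
  rw [jacobiTheta₂_term, e2]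
  congr 1; ring

lemma sqrt_scale (N : ℕ) (hN : 0 < N) (w : ℂ) :
    (w / N) ^ (1 / 2 : ℂ) = w ^ (1 / 2 : ℂ) / (Real.sqrt (N : ℝ) : ℂ) := by
  have hN' : (0 : ℝ) < N := by exact_mod_cast hN
  by_cases hw : w = 0
  · subst hw; simp
  have h1 : (Real.sqrt (N : ℝ) : ℂ) = ((N : ℝ) : ℂ) ^ (1 / 2 : ℂ) := by
    rw [Real.sqrt_eq_rpow, Complex.ofReal_cpow hN'.le]; norm_num
  have hs : (Real.sqrt (N : ℝ) : ℂ) ≠ 0 := by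
    exact_mod_cast (Real.sqrt_pos.2 hN').ne'
  have hNc : (N : ℂ) ≠ 0 := by exact_mod_cast hN.ne'
  rw [eq_div_iff hs, h1]
  have hx : w / N ≠ 0 := div_ne_zero hw hNc
  have h2 : w = ((N : ℝ) : ℂ) * (w / N) := by push_cast; field_simp
  conv_rhs => rw [h2]
  rw [Complex.cpow_def_of_ne_zero hx, Complex.cpow_def_of_ne_zero (by exact_mod_cast hN'.ne'),
    Complex.cpow_def_of_ne_zero (by rw [← h2]; exact hw), Complex.log_ofReal_mul hN' hx,
    ← Complex.exp_add, Complex.ofReal_log hN'.le]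
  congr 1; ring

lemma tsum_divMod (N : ℕ) [NeZero N] (F : ℤ → ℂ) (hF : Summable F) :
    ∑' r, F r = ∑ ν ∈ Finset.range N, ∑' j : ℤ, F (j * N + ν) := by
  have e := (Int.divModEquiv N).symm
  have h1 := (Int.divModEquiv N).symm.tsum_eq F
  have h2 := (Int.divModEquiv N).symm.summable_iff.2 hF
  rw [← h1]
  change ∑' x, (F ∘ (Int.divModEquiv N).symm) x = _
  rw [← (Equiv.prodComm (Fin N) ℤ).tsum_eq]
  have h3 := (Equiv.prodComm (Fin N) ℤ).summable_iff.2 h2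
  change ∑' x, ((F ∘ (Int.divModEquiv N).symm) ∘ (Equiv.prodComm (Fin N) ℤ)) x = _
  rw [h3.tsum_prod, tsum_fintype, Finset.sum_range]
  rfl

lemma theta_S (M : ℕ) (ν : ℤ) (τ w : ℂ) (hτ : 0 < τ.im) :
    jtheta (-1) ((ν : ℂ) + 1 / 2) ((M : ℂ) / 2 + 1 / 2) (-1 / τ) (w / τ) =
      (-(I * τ)) ^ (1 / 2 : ℂ) / (Real.sqrt ((M : ℝ) + 1) : ℂ) *
        e2 (((M : ℂ) / 2 + 1 / 2) * w ^ 2 / (4 * τ)) *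
        ∑ ν' ∈ Finset.range (M + 1),
          e2 (-(((ν : ℂ) + 1 / 2) * ((ν' : ℂ) + 1 / 2)) / (2 * ((M : ℂ) / 2 + 1 / 2))) *
          jtheta (-1) ((ν' : ℂ) + 1 / 2) ((M : ℂ) / 2 + 1 / 2) τ w := by
  have hτ0 := tau_ne hτ
  have h0 := M1_ne M
  have h12 : 2 * ((M : ℂ) / 2 + 1 / 2) = M + 1 := by ring
  set a : ℂ := (ν + 1 / 2) / (M + 1) with ha
  have haN : (M + 1) * a = ν + 1 / 2 := by rw [ha]; field_simp
  set Z : ℂ := -a + τ / (2 * (M + 1)) + w / 2 with hZ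
  have him : 0 < (τ / (M + 1) / 2).im := by
    have : τ / (M + 1) / 2 = (((2 * ((M : ℝ) + 1))⁻¹ : ℝ) : ℂ) * τ := by
      push_cast; field_simp
    rw [this, Complex.im_ofReal_mul]; positivity
  have hFs := summable_gauss (τ / (M + 1) / 2) Z (-a / 2 + τ / (8 * (M + 1)) + w / 4) him
  have hR : ∑ ν' ∈ Finset.range (M + 1),
          e2 (-(((ν : ℂ) + 1 / 2) * ((ν' : ℂ) + 1 / 2)) / (2 * ((M : ℂ) / 2 + 1 / 2))) *
          jtheta (-1) ((ν' : ℂ) + 1 / 2) ((M : ℂ) / 2 + 1 / 2) τ w =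
      e2 (-a / 2 + τ / (8 * (M + 1)) + w / 4) * jacobiTheta₂ Z (τ / (M + 1)) := by
    have h1 := tsum_divMod (M + 1) _ hFs
    have h2 : e2 (-a / 2 + τ / (8 * (M + 1)) + w / 4) * jacobiTheta₂ Z (τ / (M + 1)) =
        ∑' r : ℤ, e2 (τ / (M + 1) / 2 * (r : ℂ) ^ 2 + Z * r +
          (-a / 2 + τ / (8 * (M + 1)) + w / 4)) := by
      rw [jtheta2_eq, ← tsum_mul_left]
      refine tsum_congr fun r => ?_
      rw [← e2_add]; congr 1; ring
    rw [h2, h1]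
    refine Finset.sum_congr rfl fun ν' _ => ?_
    rw [jtheta, ← tsum_mul_left, h12]
    refine tsum_congr fun j => ?_
    rw [neg_one_zpow_eq, ← e2_add, ← e2_add]
    refine e2_congr (j * (ν + 1)) ?_
    rw [hZ, ha]
    push_cast
    field_simp
    ring
  have hL : jtheta (-1) ((ν : ℂ) + 1 / 2) ((M : ℂ) / 2 + 1 / 2) (-1 / τ) (w / τ) =
      e2 (-((M + 1) * a ^ 2) / (2 * τ) + (M + 1) * a * w / (2 * τ)) *
        jacobiTheta₂ (Z / (τ / (M + 1))) (-1 / (τ / (M + 1))) := by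
    rw [jtheta2_eq, jtheta, ← tsum_mul_left, h12]
    refine tsum_congr fun j => ?_
    rw [neg_one_zpow_eq, ← e2_add, ← e2_add, ← ha]
    congr 1
    rw [hZ]
    field_simp
    ring
  rw [hR, hL, jacobiTheta₂_functional_equation Z (τ / (M + 1))]
  have hsq : (-I * (τ / (M + 1))) ^ (1 / 2 : ℂ) =
      (-(I * τ)) ^ (1 / 2 : ℂ) / (Real.sqrt ((M : ℝ) + 1) : ℂ) := by
    have := sqrt_scale (M + 1) (Nat.succ_pos M) (-(I * τ))
    push_cast at this
    rw [← this]; congr 1; ring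
  have hne : (-(I * τ)) ^ (1 / 2 : ℂ) / (Real.sqrt ((M : ℝ) + 1) : ℂ) ≠ 0 := by
    apply div_ne_zero
    · rw [Complex.cpow_def_of_ne_zero (neg_ne_zero.2 (mul_ne_zero I_ne_zero hτ0))]
      exact Complex.exp_ne_zero _
    · exact_mod_cast (Real.sqrt_pos.2 (by positivity : (0 : ℝ) < (M : ℝ) + 1)).ne'
  rw [hsq]
  set S := (-(I * τ)) ^ (1 / 2 : ℂ) / (Real.sqrt ((M : ℝ) + 1) : ℂ)
  have hex : cexp (-(Real.pi : ℂ) * I * Z ^ 2 / (τ / (M + 1))) =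
      e2 (-(Z ^ 2 / (2 * (τ / (M + 1))))) := by
    rw [e2]; congr 1; field_simp
  rw [hex]
  have hee : e2 (-((M + 1) * a ^ 2) / (2 * τ) + (M + 1) * a * w / (2 * τ)) =
      e2 (((M : ℂ) / 2 + 1 / 2) * w ^ 2 / (4 * τ)) *
      (e2 (-a / 2 + τ / (8 * (M + 1)) + w / 4) * e2 (-(Z ^ 2 / (2 * (τ / (M + 1)))))) := by
    rw [← e2_add, ← e2_add]; congr 1; rw [hZ]; field_simp; ring
  rw [hee]
  field_simp

/-! ### Extraction of a single `n` -/

lemma jtheta_shift (M : ℕ) (hM : 0 < M) (n b : ℤ) (τ z : ℂ) :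
    jtheta 1 n ((M : ℂ) / 2) τ (z - b / ((M : ℂ) / 2)) =
      e2 (-(n * b / M)) * jtheta 1 n ((M : ℂ) / 2) τ z := by
  have hM0 : (M : ℂ) ≠ 0 := by exact_mod_cast hM.ne'
  rw [jtheta, jtheta, ← tsum_mul_left]
  refine tsum_congr fun j => ?_
  rw [one_zpow, one_mul, one_mul, ← e2_add]
  refine e2_congr (-(j * b)) ?_
  push_cast; field_simp; ring

lemma hfun_shift (M : ℕ) (hM : 0 < M) (n ν b : ℤ) (τ z : ℂ) :
    hfun ((M : ℂ) / 2) n ν τ (z - b / ((M : ℂ) / 2)) =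
      e2 (-(n * b / M)) * hfun ((M : ℂ) / 2) n ν τ z := by
  have hM0 : (M : ℂ) ≠ 0 := by exact_mod_cast hM.ne'
  rw [hfun, hfun, ← tsum_mul_left]
  refine tsum_congr fun j => ?_
  rw [mul_div_assoc' (e2 _), ← e2_add]
  congr 1
  · refine e2_congr (-(j * b)) ?_
    push_cast; field_simp; ring
  · congr 1
    refine e2_congr (-b) ?_
    push_cast; field_simp; ring

lemma Gfun_shift (M : ℕ) (hM : 0 < M) (n ν b : ℤ) (τ z : ℂ) :
    Gfun ((M : ℂ) / 2) n ν τ (z - b / ((M : ℂ) / 2)) =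
      e2 (-(n * b / M)) * Gfun ((M : ℂ) / 2) n ν τ z := by
  rw [Gfun, Gfun, jtheta_shift M hM, hfun_shift M hM]; ring

lemma orth (M : ℕ) (hM : 0 < M) (n n' : ℤ) (hn : 0 ≤ n ∧ n < M) (hn' : 0 ≤ n' ∧ n' < M) :
    ∑ l ∈ Finset.range M, e2 (n * l / M) * e2 (-(n' * l / M)) = if n' = n then (M : ℂ) else 0 := by
  have hM0 : (M : ℂ) ≠ 0 := by exact_mod_cast hM.ne'
  have h1 : ∀ l : ℕ, e2 (n * l / M) * e2 (-(n' * l / M)) = e2 (((n - n' : ℤ) : ℂ) / M) ^ l := by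
    intro l
    rw [← e2_add, ← e2_nat_mul]; congr 1; push_cast; ring
  simp only [h1]
  split_ifs with h
  · subst h; simp [e2_zero]
  · have hne : e2 (((n - n' : ℤ) : ℂ) / M) ≠ 1 := by
      intro he
      obtain ⟨k, hk⟩ := (e2_eq_one_iff _).1 he
      rw [div_eq_iff hM0] at hk
      have hk' : n - n' = k * M := by exact_mod_cast hk
      have hk0 : k = 0 := by
        have : k < 1 := by by_contra hc; nlinarith
        have : -1 < k := by by_contra hc; nlinarith
        omega
      rw [hk0] at hk'
      omega
    rw [geom_sum_eq hne, ← e2_nat_mul, mul_div_cancel₀ _ hM0, e2_int, sub_self, zero_div]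

lemma Gfun_extract (M : ℕ) (hM : 0 < M) (n ν : ℤ) (hn : 0 ≤ n ∧ n < M) (τ z : ℂ) :
    Gfun ((M : ℂ) / 2) n ν τ z = 1 / M * ∑ l ∈ Finset.range M, e2 (n * l / M) *
      ∑ n' ∈ Finset.range M, Gfun ((M : ℂ) / 2) (n' : ℤ) ν τ (z - l / ((M : ℂ) / 2)) := by
  have hM0 : (M : ℂ) ≠ 0 := by exact_mod_cast hM.ne'
  have h1 : ∀ l n' : ℕ, e2 (n * l / M) *
      Gfun ((M : ℂ) / 2) (n' : ℤ) ν τ (z - l / ((M : ℂ) / 2)) =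
      e2 (n * l / M) * e2 (-(((n' : ℤ) : ℂ) * l / M)) * Gfun ((M : ℂ) / 2) (n' : ℤ) ν τ z := by
    intro l n'
    have := Gfun_shift M hM n' ν l τ z
    rw [Int.cast_natCast l] at this
    rw [this]; ring
  simp only [Finset.mul_sum, h1]
  rw [Finset.sum_comm]
  simp only [← Finset.mul_sum, ← Finset.sum_mul]
  have h2 : ∀ n' ∈ Finset.range M, (∑ l ∈ Finset.range M, e2 (n * l / M) *
      e2 (-(((n' : ℤ) : ℂ) * l / M))) * Gfun ((M : ℂ) / 2) (n' : ℤ) ν τ z =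
      if n' = n.toNat then M * Gfun ((M : ℂ) / 2) n ν τ z else 0 := by
    intro n' hn'
    rw [Finset.mem_range] at hn'
    rw [orth M hM n n' hn (by omega)]
    by_cases h : (n' : ℤ) = n
    · rw [if_pos h, if_pos (by omega), h]
    · rw [if_neg h, if_neg (by omega), zero_mul]
  rw [Finset.sum_congr rfl h2, Finset.sum_ite_eq', if_pos (by rw [Finset.mem_range]; omega)]
  field_simp

lemma OffH_of (M : ℕ) (τ z : ℂ) (hz : ∀ a b : ℤ, (M : ℂ) / 2 * z ≠ (a : ℂ) + (b : ℂ) * τ) :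
    OffH M τ z := by
  intro k hk
  obtain ⟨a, ha⟩ := (e2_eq_one_iff _).1 (sub_eq_zero.1 hk).symm
  refine hz a (-(k * M)) ?_
  push_cast
  linear_combination ha

theorem stmt_11 (M : ℕ) (hM : 0 < M) (m : ℂ) (hm : m = (M : ℂ) / 2)
    (n ν : ℤ) (hn : 0 ≤ n ∧ n < (M : ℤ)) (hν : 0 ≤ ν ∧ ν ≤ (M : ℤ))
    (τ : ℂ) (hτ : 0 < τ.im) (z : ℂ)
    (hz : ∀ a b : ℤ, m * z ≠ (a : ℂ) + (b : ℂ) * τ) :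
    Gfun m n ν (-1 / τ) (z / τ) =
      Complex.I * (-(Complex.I * τ)) ^ ((3 : ℂ) / 2) /
          (2 * m * (Real.sqrt ((M : ℝ) + 1) : ℂ)) *
        ∑ n' ∈ Finset.range M, ∑ ν' ∈ Finset.range (M + 1), ∑ ℓ ∈ Finset.range M,
          (-1 : ℂ) ^ (ν + (ν' : ℤ)) * e2 ((n : ℂ) * (ℓ : ℂ) / (2 * m)) *
            e2 (-(((ν : ℂ) + 1 / 2) * ((ν' : ℂ) + 1 / 2)) / (2 * (m + 1 / 2))) *
            e2 (m * z ^ 2 / (4 * τ)) * e2 (-((ℓ : ℂ) * z) / 2) *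
            e2 ((ℓ : ℂ) ^ 2 / (4 * m) * τ) *
            Gfun m (n' : ℤ) (ν' : ℤ) τ (z - (ℓ : ℂ) * τ / m) := by
  subst hm
  have hM0 : (M : ℂ) ≠ 0 := by exact_mod_cast hM.ne'
  have hτ0 := tau_ne hτ
  have hS := S_im hτ
  have hw : ∀ l : ℕ, ∀ a b : ℤ, (M : ℂ) / 2 * (z - (l : ℂ) * τ / ((M : ℂ) / 2)) ≠ a + b * τ := by
    intro l a b h
    refine hz a (b + l) ?_
    have : (M : ℂ) / 2 * (z - (l : ℂ) * τ / ((M : ℂ) / 2)) = M / 2 * z - l * τ := by field_simp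
    rw [this] at h
    push_cast
    linear_combination h
  have hO : ∀ l : ℕ, OffH M τ (z - (l : ℂ) * τ / ((M : ℂ) / 2)) := fun l => OffH_of M τ _ (hw l)
  have hO' : ∀ l : ℕ, OffH M (-1 / τ) ((z - (l : ℂ) * τ / ((M : ℂ) / 2)) / τ) := by
    refine fun l => OffH_of M _ _ fun a b h => hw l (-b) a ?_
    rw [mul_div_assoc', div_eq_iff hτ0] at h
    rw [h]
    push_cast
    field_simp
    ring
  have hpre : I * (-(I * τ)) ^ ((3 : ℂ) / 2) = τ * (-(I * τ)) ^ (1 / 2 : ℂ) := by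
    rw [show (3 : ℂ) / 2 = 1 + 1 / 2 by norm_num,
      Complex.cpow_add _ _ (neg_ne_zero.2 (mul_ne_zero I_ne_zero hτ0)), Complex.cpow_one]
    linear_combination (-(τ * (-(I * τ)) ^ (1 / 2 : ℂ))) * I_mul_I
  have hkey : ∀ l : ℕ, ∑ n' ∈ Finset.range M,
      Gfun ((M : ℂ) / 2) (n' : ℤ) ν (-1 / τ) (z / τ - l / ((M : ℂ) / 2)) =
      τ * ((-(I * τ)) ^ (1 / 2 : ℂ) / (Real.sqrt ((M : ℝ) + 1) : ℂ)) *
      ∑ ν' ∈ Finset.range (M + 1), (-1 : ℂ) ^ (ν + (ν' : ℤ)) *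
        e2 (-(((ν : ℂ) + 1 / 2) * ((ν' : ℂ) + 1 / 2)) / (2 * ((M : ℂ) / 2 + 1 / 2))) *
            e2 ((M : ℂ) / 2 * z ^ 2 / (4 * τ)) * e2 (-((l : ℂ) * z) / 2) *
            e2 ((l : ℂ) ^ 2 / (4 * ((M : ℂ) / 2)) * τ) *
        ∑ n' ∈ Finset.range M,
          Gfun ((M : ℂ) / 2) (n' : ℤ) (ν' : ℤ) τ (z - (l : ℂ) * τ / ((M : ℂ) / 2)) := by
    intro l
    have harg : z / τ - l / ((M : ℂ) / 2) = (z - (l : ℂ) * τ / ((M : ℂ) / 2)) / τ := by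
      field_simp
    have hexp : ∀ w : ℂ, w = z - (l : ℂ) * τ / ((M : ℂ) / 2) →
        e2 (-((w / 2) ^ 2 / (2 * τ))) * e2 (((M : ℂ) / 2 + 1 / 2) * w ^ 2 / (4 * τ)) =
        e2 ((M : ℂ) / 2 * z ^ 2 / (4 * τ)) * e2 (-((l : ℂ) * z) / 2) *
            e2 ((l : ℂ) ^ 2 / (4 * ((M : ℂ) / 2)) * τ) := by
      intro w hw
      rw [← e2_add, ← e2_add, ← e2_add, hw]
      congr 1; field_simp; ring
    have hexp' := hexp _ rfl
    have hO1 := hO l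
    have hO2 := hO' l
    rw [harg]
    generalize z - (l : ℂ) * τ / ((M : ℂ) / 2) = w at *
    rw [Gtot_eq M hM ν _ _ hS hO2, theta_S M ν τ w hτ,
      show w / τ / 2 = w / 2 / τ by ring, Jfun_S τ (w / 2) hτ hO1.off, Finset.mul_sum,
      Finset.mul_sum, Finset.mul_sum]
    refine Finset.sum_congr rfl fun ν' _ => ?_
    rw [Gtot_eq M hM ν' _ _ hτ hO1, zpow_add₀ (by norm_num : (-1 : ℂ) ≠ 0), Int.cast_natCast]
    have hsq : (-1 : ℂ) ^ (ν' : ℤ) * (-1 : ℂ) ^ (ν' : ℤ) = 1 := by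
      rw [← mul_zpow]; norm_num
    have hsq' : ∀ X : ℂ, X = X * ((-1 : ℂ) ^ (ν' : ℤ) * (-1 : ℂ) ^ (ν' : ℤ)) := by
      intro X; rw [hsq, mul_one]
    have hassoc : ∀ c x y j s x2 t1 t2 p : ℂ, x * x2 = y →
        c * (τ * x * j) * (s * x2 * (t1 * t2)) * (p * p) =
          τ * s * (c * p * t1 * y * (p * j * t2)) := by
      intro c x y j s x2 t1 t2 p h
      rw [← h]; ring
    rw [hsq' ((-1 : ℂ) ^ ν * _ * _), hassoc _ _ _ _ _ _ _ _ _ hexp']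
    ring
  rw [Gfun_extract M hM n ν hn, hpre]
  simp only [hkey]
  have hre : ∀ f : ℕ → ℕ → ℕ → ℂ, ∑ n' ∈ Finset.range M, ∑ ν' ∈ Finset.range (M + 1),
      ∑ l ∈ Finset.range M, f n' ν' l = ∑ l ∈ Finset.range M, ∑ ν' ∈ Finset.range (M + 1),
      ∑ n' ∈ Finset.range M, f n' ν' l := by
    intro f
    rw [Finset.sum_comm]
    simp only [fun ν' => Finset.sum_comm (s := Finset.range M) (t := Finset.range M)
      (f := fun n' l => f n' ν' l)]
    rw [Finset.sum_comm]
  rw [hre]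
  simp only [Finset.mul_sum]
  refine Finset.sum_congr rfl fun l _ => Finset.sum_congr rfl fun ν' _ =>
    Finset.sum_congr rfl fun n' _ => ?_
  rw [show 2 * ((M : ℂ) / 2) = M by ring]
  ring
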